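/- Let p be an odd prime, s = 2er = 2ℓt with r odd and t even, q = p^s, N = p^ℓ+1, and d₀ = gcd(N/2, (√q-1)/(p^e-1)). If d₀ > 1, then for each integer 1 ≤ b ≤ d₀-1 there exists a (b(√q-1)/(d₀(p^e-1)))-ovoid in the symplectic polar space W(2r-1, p^e). -/

import Mathlib

open Module

section CyclicGroup

variable {G : Type*} [CommGroup G] [Fintype G] [IsCyclic G] {n m : ℕ}

theorem IsCyclic.exists_pow_eq_of_pow_eq_one (h : n * m = Fintype.card G) {u : G}
    (hu : u ^ m = 1) : ∃ y : G, y ^ n = u := by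
  obtain ⟨g, hg⟩ := IsCyclic.exists_generator (α := G)
  obtain ⟨k, rfl⟩ := Subgroup.mem_zpowers_iff.1 (hg u)
  have hm : 0 < m := Nat.pos_of_ne_zero fun h0 => by
    have := Fintype.card_pos (α := G); simp [← h, h0] at this
  have hord : orderOf g = n * m := by
    rw [orderOf_eq_card_of_forall_mem_zpowers hg, Nat.card_eq_fintype_card, h]
  rw [← zpow_natCast, ← zpow_mul, ← orderOf_dvd_iff_zpow_eq_one, hord] at hu
  push_cast at hu
  obtain ⟨j, rfl⟩ := Int.dvd_of_mul_dvd_mul_right (by exact_mod_cast hm.ne') hu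
  exact ⟨g ^ j, by rw [← zpow_natCast, ← zpow_mul, mul_comm]⟩

variable [DecidableEq G]

theorem IsCyclic.card_filter_pow_eq_one (h : n * m = Fintype.card G) :
    (Finset.univ.filter fun z : G => z ^ n = 1).card = n := by
  have := IsCyclic.card_powMonoidHom_ker (G := G) n
  rw [Nat.card_eq_fintype_card (α := G), ← h, Nat.gcd_comm, Nat.gcd_mul_right_right] at this
  rw [← Fintype.card_subtype, ← Nat.card_eq_fintype_card]
  simpa [MonoidHom.mem_ker] using this

theorem IsCyclic.card_filter_pow_eq (h : n * m = Fintype.card G) {u : G} (hu : u ^ m = 1) :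
    (Finset.univ.filter fun z : G => z ^ n = u).card = n := by
  obtain ⟨y, rfl⟩ := IsCyclic.exists_pow_eq_of_pow_eq_one h hu
  refine Eq.trans ?_ (IsCyclic.card_filter_pow_eq_one h)
  refine Finset.card_bij' (fun z _ => z * y⁻¹) (fun z _ => z * y) ?_ ?_ ?_ ?_ <;>
    simp +contextual [mul_pow]

theorem IsCyclic.sum_comp_pow {M : Type*} [Semiring M] (h : n * m = Fintype.card G) (F : G → M) :
    ∑ x, F (x ^ n) = n * ∑ u with u ^ m = 1, F u := by
  have key : ∀ x ∈ (Finset.univ : Finset G), x ^ n ∈ Finset.univ.filter fun u : G => u ^ m = 1 := by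
    intro x _
    simp [← pow_mul, h]
  rw [← Finset.sum_fiberwise_of_maps_to key, Finset.mul_sum]
  refine Finset.sum_congr rfl fun u hu => ?_
  rw [Finset.sum_congr rfl (g := fun _ => F u) (by simp +contextual), Finset.sum_const,
    IsCyclic.card_filter_pow_eq h (Finset.mem_filter.1 hu).2, nsmul_eq_mul]

end CyclicGroup

open Classical in
theorem exists_inv_closed_finset_card_two_mul {G : Type*} [CommGroup G] [Fintype G]
    (hodd : Odd (Fintype.card G)) (k : ℕ) (hk : 2 * k + 1 ≤ Fintype.card G) :
    ∃ S : Finset G, (∀ x ∈ S, x⁻¹ ∈ S) ∧ 1 ∉ S ∧ S.card = 2 * k := by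
  induction k with
  | zero => exact ⟨∅, by simp⟩
  | succ k ih =>
    obtain ⟨S, hS, h1, hc⟩ := ih (by omega)
    obtain ⟨x, hx⟩ : ∃ x, x ∉ insert 1 S := by
      by_contra! hall
      have := Finset.card_le_card (fun x _ => hall x : Finset.univ ⊆ insert 1 S)
      rw [Finset.card_insert_of_notMem h1, Finset.card_univ] at this
      omega
    simp only [Finset.mem_insert, not_or] at hx
    have hxx : x ≠ x⁻¹ := fun h => hx.1 <| by
      have h2 : x ^ 2 = 1 := by rw [sq]; nth_rewrite 2 [h]; simp
      have := Nat.Coprime.pow_left_bijective (G := G) (n := 2)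
        (by rw [Nat.card_eq_fintype_card]; exact hodd.coprime_two_right)
      exact this.1 (by simpa using h2)
    have hxi : x⁻¹ ∉ S := fun h => hx.2 (by simpa using hS _ h)
    refine ⟨insert x (insert x⁻¹ S), ?_, ?_, ?_⟩
    · intro y hy
      simp only [Finset.mem_insert] at hy ⊢
      rcases hy with rfl | rfl | hy
      · simp
      · simp
      · exact .inr (.inr (hS y hy))
    · simp [h1, hx.1, eq_comm]
    · rw [Finset.card_insert_of_notMem (by simp [hxx, hx.2]), Finset.card_insert_of_notMem hxi, hc]
      ring

theorem exists_inv_closed_finset_card_eq {G : Type*} [CommGroup G] [Fintype G]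
    (hodd : Odd (Fintype.card G)) (b : ℕ) (hb : b ≤ Fintype.card G) :
    ∃ S : Finset G, (∀ x, x⁻¹ ∈ S ↔ x ∈ S) ∧ S.card = b := by
  classical
  suffices ∃ S : Finset G, (∀ x ∈ S, x⁻¹ ∈ S) ∧ S.card = b by
    obtain ⟨S, hS, hc⟩ := this
    exact ⟨S, fun x => ⟨fun h => by simpa using hS _ h, hS x⟩, hc⟩
  rcases Nat.even_or_odd' b with ⟨k, rfl | rfl⟩
  · have := Nat.odd_iff.1 hodd
    obtain ⟨S, hS, -, hc⟩ := exists_inv_closed_finset_card_two_mul hodd k (by omega)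
    exact ⟨S, hS, hc⟩
  · obtain ⟨S, hS, h1, hc⟩ := exists_inv_closed_finset_card_two_mul hodd k hb
    refine ⟨insert 1 S, ?_, by rw [Finset.card_insert_of_notMem h1, hc]⟩
    intro x hx
    rcases Finset.mem_insert.1 hx with rfl | hx
    · simp
    · exact Finset.mem_insert_of_mem (hS x hx)

theorem AddChar.eq_one_of_map_neg_eq {L : Type*} [Ring L] {p : ℕ} [CharP L p] (hp : Odd p)
    (ψ : AddChar L ℂ) {w : L} (hw : ψ (-w) = ψ w) : ψ w = 1 := by
  have h2 : ψ w ^ 2 = 1 := by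
    rw [sq]; nth_rewrite 1 [← hw]; rw [← AddChar.map_add_eq_mul]; simp
  have hp1 : ψ w ^ p = 1 := by
    rw [← AddChar.map_nsmul_eq_pow]; simp
  obtain ⟨k, rfl⟩ := hp
  rwa [pow_succ, pow_mul, h2, one_pow, one_mul] at hp1

theorem sum_eq_zero_add_sum_units {L M : Type*} [Field L] [Fintype L] [AddCommMonoid M]
    [DecidableEq L] (g : L → M) : ∑ x, g x = g 0 + ∑ u : Lˣ, g u := by
  rw [Fintype.sum_eq_add_sum_subtype_ne g 0]
  congr 1
  exact (Fintype.sum_equiv unitsEquivNeZero _ _ fun u => rfl).symm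

section HermitianSum

variable {L : Type*} [Field L] [Fintype L] [DecidableEq L] {p ℓ : ℕ} [Fact p.Prime] [CharP L p]

theorem sum_mul_sum_neg_eq (hp : Odd p) {ψ : AddChar L ℂ} (hψ : ψ ≠ 1)
    (hF : ∀ x, ψ (x ^ p ^ ℓ) = ψ x) (a : L) :
    (∑ x, ψ (a * x ^ (p ^ ℓ + 1))) * ∑ x, ψ (-a * x ^ (p ^ ℓ + 1)) =
      Fintype.card L *
        (Finset.univ.filter fun z : L => a ^ p ^ ℓ * z ^ (p ^ ℓ) ^ 2 + a * z = 0).card := by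
  have hprim := AddChar.IsPrimitive.of_ne_one hψ
  have hbij : Function.Bijective fun y : L => y ^ p ^ ℓ :=
    Finite.injective_iff_bijective.1 (iterateFrobenius_inj L p ℓ)
  have inner (z : L) : ∑ y, ψ (a * (y + z) ^ (p ^ ℓ + 1)) * ψ (-a * y ^ (p ^ ℓ + 1)) =
      if a ^ p ^ ℓ * z ^ (p ^ ℓ) ^ 2 + a * z = 0 then (Fintype.card L : ℂ) else 0 := by
    have hterm (y : L) : ψ (a * (y + z) ^ (p ^ ℓ + 1)) * ψ (-a * y ^ (p ^ ℓ + 1)) =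
        ψ (a * z ^ (p ^ ℓ + 1)) *
          ψ (y ^ p ^ ℓ * (a ^ p ^ ℓ * z ^ (p ^ ℓ) ^ 2 + a * z)) := by
      have e1 : ψ (a * z ^ p ^ ℓ * y) = ψ (a ^ p ^ ℓ * z ^ (p ^ ℓ) ^ 2 * y ^ p ^ ℓ) := by
        rw [← hF (a * z ^ p ^ ℓ * y), mul_pow, mul_pow, ← pow_mul, ← sq]
      rw [← AddChar.map_add_eq_mul,
        show a * (y + z) ^ (p ^ ℓ + 1) + -a * y ^ (p ^ ℓ + 1) =
          a * z ^ (p ^ ℓ + 1) + a * z ^ p ^ ℓ * y + a * z * y ^ p ^ ℓ by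
            rw [pow_succ (y + z), add_pow_char_pow]; ring,
        AddChar.map_add_eq_mul, AddChar.map_add_eq_mul, e1, mul_assoc,
        ← AddChar.map_add_eq_mul]
      congr 2
      ring
    simp_rw [hterm]
    rw [← Finset.mul_sum,
      hbij.sum_comp fun y => ψ (y * (a ^ p ^ ℓ * z ^ (p ^ ℓ) ^ 2 + a * z)),
      AddChar.sum_mulShift _ hprim]
    split_ifs with h0
    · have : ψ (a * z ^ (p ^ ℓ + 1)) = 1 := by
        refine AddChar.eq_one_of_map_neg_eq hp ψ ?_
        rw [← hF (a * z ^ (p ^ ℓ + 1))]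
        congr 1
        linear_combination -z ^ p ^ ℓ * h0
      rw [this, one_mul]
    · simp
  rw [Finset.sum_mul_sum, Finset.sum_comm]
  have shift (y : L) : ∑ x, ψ (a * x ^ (p ^ ℓ + 1)) * ψ (-a * y ^ (p ^ ℓ + 1)) =
      ∑ z, ψ (a * (y + z) ^ (p ^ ℓ + 1)) * ψ (-a * y ^ (p ^ ℓ + 1)) :=
    (Equiv.sum_comp (Equiv.addLeft y)
      fun x : L => ψ (a * x ^ (p ^ ℓ + 1)) * ψ (-a * y ^ (p ^ ℓ + 1))).symm
  simp_rw [shift]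
  rw [Finset.sum_comm]
  simp_rw [inner]
  rw [← Finset.sum_filter, Finset.sum_const, nsmul_eq_mul, mul_comm]

end HermitianSum

theorem Int.dvd_of_isIntegral_mul_eq {n c : ℤ} (hn : n ≠ 0) {η : ℂ} (hη : IsIntegral ℤ η)
    (h : n * η = c) : n ∣ c := by
  have hr : η = algebraMap ℚ ℂ ((c : ℚ) / n) := by
    have : (n : ℂ) ≠ 0 := by exact_mod_cast hn
    simp [← h, this]
  rw [hr, isIntegral_algebraMap_iff (algebraMap ℚ ℂ).injective,
    IsIntegrallyClosed.isIntegral_iff] at hη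
  obtain ⟨y, hy⟩ := hη
  refine ⟨y, ?_⟩
  have : (n : ℚ) ≠ 0 := by exact_mod_cast hn
  rw [eq_div_iff this] at hy
  have : ((y * n : ℤ) : ℚ) = c := by simpa using hy
  rw [mul_comm]
  exact_mod_cast this.symm

theorem AddChar.isIntegral_apply {L : Type*} [Ring L] [Finite L] (ψ : AddChar L ℂ) (x : L) :
    IsIntegral ℤ (ψ x) := by
  have hpos : 0 < Nat.card L := Nat.card_pos
  refine IsIntegral.of_pow hpos ?_
  rw [← AddChar.map_nsmul_eq_pow, card_nsmul_eq_zero']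
  simpa using isIntegral_one

theorem Nat.add_one_not_dvd_pow_add_one {P t : ℕ} (hP : 2 ≤ P) (ht : Even t) :
    ¬ ((P : ℤ) + 1 ∣ (P : ℤ) ^ t + 1) := by
  intro h
  have h1 : (P : ℤ) + 1 ∣ (P : ℤ) ^ t - 1 := by
    have := sub_dvd_pow_sub_pow (P : ℤ) (-1) t
    rwa [ht.neg_one_pow, sub_neg_eq_add] at this
  have h2 := Int.le_of_dvd (by norm_num) (by simpa using Int.dvd_sub h h1 : (P : ℤ) + 1 ∣ 1 + 1)
  omega

theorem Nat.add_one_not_dvd_pow_succ_sub_one {P t : ℕ} (hP : 2 ≤ P) (ht : Even t) :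
    ¬ ((P : ℤ) + 1 ∣ (P : ℤ) ^ (t + 1) - 1) := by
  intro h
  refine Nat.add_one_not_dvd_pow_add_one hP ht ?_
  have : (P : ℤ) ^ t + 1 = ((P : ℤ) + 1) * P ^ t - (P ^ (t + 1) - 1) := by ring
  rw [this]
  exact Int.dvd_sub (dvd_mul_right _ _) h

section HermitianSum

variable {L : Type*} [Field L] {p ℓ t k : ℕ} [Fact p.Prime]

theorem pow_mul_pow_sq_add_mul_eq_zero_iff {P : ℕ} (hP : 1 ≤ P) (a z : Lˣ) :
    (a : L) ^ P * (z : L) ^ P ^ 2 + a * z = 0 ↔ (a * z ^ (P + 1)) ^ (P - 1) = -1 := by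
  obtain ⟨m, rfl⟩ := Nat.exists_eq_add_of_le' hP
  rw [Nat.add_sub_cancel, Units.ext_iff]
  push_cast
  rw [show (a : L) ^ (m + 1) * (z : L) ^ (m + 1) ^ 2 + a * z =
    a * z * ((a * (z : L) ^ (m + 1 + 1)) ^ m + 1) by ring, mul_eq_zero_iff_left (by simp),
    add_eq_zero_iff_eq_neg]

variable [Fintype L] [DecidableEq L]

theorem card_filter_radical_of_eq {P : ℕ} (hP : 1 ≤ P)
    (hk : (P - 1) * ((P + 1) * k) = Fintype.card Lˣ)
    {β : Lˣ} (hβ : β ^ (P - 1) = -1) {a : Lˣ} (ha : (a * β⁻¹) ^ ((P - 1) * k) = 1) :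
    (Finset.univ.filter fun z : Lˣ =>
      (a : L) ^ P * (z : L) ^ P ^ 2 + a * z = 0).card = P ^ 2 - 1 := by
  have hsq : P ^ 2 - 1 = (P + 1) * (P - 1) := by
    zify [hP, Nat.one_le_pow 2 P hP]; ring
  obtain ⟨y, hy⟩ := IsCyclic.exists_pow_eq_of_pow_eq_one (n := P + 1)
    (by rw [← hk]; ring : (P + 1) * ((P - 1) * k) = Fintype.card Lˣ) ha
  obtain rfl : a = y ^ (P + 1) * β := by rw [hy]; simp
  have hn : (P ^ 2 - 1) * k = Fintype.card Lˣ := by rw [← hk, hsq]; ring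
  have hu : ((y⁻¹ : Lˣ) ^ (P ^ 2 - 1)) ^ k = 1 := by rw [← pow_mul, hn, pow_card_eq_one]
  rw [← IsCyclic.card_filter_pow_eq hn hu]
  congr 1
  ext z
  simp only [Finset.mem_filter, Finset.mem_univ, true_and]
  rw [pow_mul_pow_sq_add_mul_eq_zero_iff hP, mul_right_comm, mul_pow, hβ, ← mul_pow,
    ← pow_mul, ← hsq, inv_pow, eq_inv_iff_mul_eq_one, ← mul_pow, mul_comm z]
  simp

theorem card_filter_radical_of_ne {P : ℕ} (hP : 1 ≤ P)
    (hk : (P - 1) * ((P + 1) * k) = Fintype.card Lˣ)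
    {β : Lˣ} (hβ : β ^ (P - 1) = -1) {a : Lˣ} (ha : (a * β⁻¹) ^ ((P - 1) * k) ≠ 1) :
    (Finset.univ.filter fun z : Lˣ =>
      (a : L) ^ P * (z : L) ^ P ^ 2 + a * z = 0).card = 0 := by
  rw [Finset.card_eq_zero, Finset.filter_eq_empty_iff]
  intro z _ hz
  rw [pow_mul_pow_sq_add_mul_eq_zero_iff hP] at hz
  refine ha ?_
  have h1 : (a * β⁻¹ * z ^ (P + 1)) ^ (P - 1) = 1 := by
    rw [mul_right_comm, mul_pow, hz, inv_pow, hβ]; simp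
  have h2 : (z ^ (P + 1)) ^ ((P - 1) * k) = 1 := by
    rw [← pow_mul, show (P + 1) * ((P - 1) * k) = Fintype.card Lˣ by rw [← hk]; ring,
      pow_card_eq_one]
  rw [← mul_one ((a * β⁻¹) ^ _), ← h2, ← mul_pow, pow_mul, h1, one_pow, h2]

variable [CharP L p]

theorem one_add_sum_units_sq (hp : Odd p) (hk : (p ^ ℓ - 1) * ((p ^ ℓ + 1) * k) = Fintype.card Lˣ)
    {ψ : AddChar L ℂ} (hψ : ψ ≠ 1) (hF : ∀ x, ψ (x ^ p ^ ℓ) = ψ x) (a : Lˣ) :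
    (1 + ∑ x : Lˣ, ψ (a * x ^ (p ^ ℓ + 1))) ^ 2 = Fintype.card L *
      (1 + (Finset.univ.filter fun z : Lˣ =>
        (a : L) ^ p ^ ℓ * (z : L) ^ (p ^ ℓ) ^ 2 + a * z = 0).card) := by
  have hP : 1 ≤ p ^ ℓ := Nat.one_le_pow _ _ (Fact.out : p.Prime).pos
  have heven : Even ((p ^ ℓ - 1) * k) := (Nat.Odd.sub_odd (hp.pow) odd_one).mul_right _
  obtain ⟨c, hc⟩ := IsCyclic.exists_pow_eq_of_pow_eq_one (n := p ^ ℓ + 1) (u := (-1 : Lˣ))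
    (by rw [← hk]; ring : (p ^ ℓ + 1) * ((p ^ ℓ - 1) * k) = Fintype.card Lˣ) heven.neg_one_pow
  have hneg : ∑ x : L, ψ (-a * x ^ (p ^ ℓ + 1)) = ∑ x : L, ψ (a * x ^ (p ^ ℓ + 1)) := by
    rw [← Equiv.sum_comp (Units.mulLeft c)]
    refine Finset.sum_congr rfl fun x _ => ?_
    have hc' : (c : L) ^ (p ^ ℓ + 1) = -1 := by simpa using congrArg Units.val hc
    simp [mul_pow, hc']
  have hmain := sum_mul_sum_neg_eq hp hψ hF (a : L)
  rw [hneg, ← sq, sum_eq_zero_add_sum_units] at hmain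
  have hz : ψ ((a : L) * 0 ^ (p ^ ℓ + 1)) = 1 := by simp
  rw [hz] at hmain
  rw [hmain, Finset.card_filter, sum_eq_zero_add_sum_units, Finset.card_filter]
  simp [(Fact.out : p.Prime).ne_zero]

theorem sum_units_eq (hp : Odd p) (hℓ : 0 < ℓ) (ht : Even t)
    (hL : Fintype.card L = ((p ^ ℓ) ^ t) ^ 2)
    (hk : (p ^ ℓ - 1) * ((p ^ ℓ + 1) * k) = Fintype.card Lˣ)
    {ψ : AddChar L ℂ} (hψ : ψ ≠ 1) (hF : ∀ x, ψ (x ^ p ^ ℓ) = ψ x)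
    {β : Lˣ} (hβ : β ^ (p ^ ℓ - 1) = -1) (a : Lˣ) :
    ∑ x : Lˣ, ψ (a * x ^ (p ^ ℓ + 1)) = ((p : ℂ) ^ ℓ) ^ t - 1 -
      if (a * β⁻¹) ^ ((p ^ ℓ - 1) * k) = 1 then ((p : ℂ) ^ ℓ) ^ t * ((p : ℂ) ^ ℓ + 1) else 0 := by
  have hP : 2 ≤ p ^ ℓ := (Fact.out : p.Prime).two_le.trans (Nat.le_self_pow hℓ.ne' p)
  have hP1 : 1 ≤ p ^ ℓ := by omega
  have hsq := one_add_sum_units_sq hp hk hψ hF a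
  have hdvd (c : ℤ) (hc : ∑ x : Lˣ, ψ (a * x ^ (p ^ ℓ + 1)) = c) : ((p ^ ℓ : ℕ) : ℤ) + 1 ∣ c := by
    have h1 := IsCyclic.sum_comp_pow
      (by rw [← hk]; ring : (p ^ ℓ + 1) * ((p ^ ℓ - 1) * k) = Fintype.card Lˣ)
      fun u : Lˣ => ψ ((a * u : Lˣ) : L)
    push_cast at h1
    refine Int.dvd_of_isIntegral_mul_eq
      (η := ∑ x : Lˣ with x ^ ((p ^ ℓ - 1) * k) = 1, ψ (a * x)) (by positivity)
      (IsIntegral.sum _ fun u _ => ψ.isIntegral_apply _) ?_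
    rw [← hc, h1]
    push_cast
    rfl
  set T := ∑ x : Lˣ, ψ (a * x ^ (p ^ ℓ + 1))
  rw [hL] at hsq
  split_ifs with h
  · rw [card_filter_radical_of_eq hP1 hk hβ h, Nat.cast_sub (Nat.one_le_pow _ _ hP1)] at hsq
    have h2 : (1 + T) ^ 2 = (((p : ℂ) ^ ℓ) ^ (t + 1)) ^ 2 := by
      rw [hsq]; push_cast; ring
    rcases sq_eq_sq_iff_eq_or_eq_neg.1 h2 with h3 | h3
    · refine absurd (hdvd (((p ^ ℓ : ℕ) : ℤ) ^ (t + 1) - 1) ?_)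
        (Nat.add_one_not_dvd_pow_succ_sub_one hP ht)
      push_cast
      linear_combination h3
    · linear_combination h3
  · rw [card_filter_radical_of_ne hP1 hk hβ h] at hsq
    have h2 : (1 + T) ^ 2 = (((p : ℂ) ^ ℓ) ^ t) ^ 2 := by
      rw [hsq]; push_cast; ring
    rcases sq_eq_sq_iff_eq_or_eq_neg.1 h2 with h3 | h3
    · linear_combination h3
    · refine absurd (hdvd (-(((p ^ ℓ : ℕ) : ℤ) ^ t + 1)) ?_) ?_
      · push_cast
        linear_combination h3
      · rw [dvd_neg]
        exact Nat.add_one_not_dvd_pow_add_one hP ht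

theorem sum_apply_mul_eq (hp : Odd p) (hℓ : 0 < ℓ) (ht : Even t)
    (hL : Fintype.card L = ((p ^ ℓ) ^ t) ^ 2)
    (hk : (p ^ ℓ - 1) * ((p ^ ℓ + 1) * k) = Fintype.card Lˣ)
    {ψ : AddChar L ℂ} (hψ : ψ ≠ 1) (hF : ∀ x, ψ (x ^ p ^ ℓ) = ψ x)
    {β : Lˣ} (hβ : β ^ (p ^ ℓ - 1) = -1) {D : Finset Lˣ}
    (hD : ∀ x y, x * y ^ (p ^ ℓ + 1) ∈ D ↔ x ∈ D) {c : ℕ}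
    (hc : D.card = c * ((p ^ ℓ) ^ t + 1)) (a : Lˣ) :
    ∑ x ∈ D, ψ (a * x) = c - ((p ^ ℓ) ^ t : ℕ) * if a⁻¹ * β ∈ D then 1 else 0 := by
  have hN : (p ^ ℓ + 1) * ((p ^ ℓ - 1) * k) = Fintype.card Lˣ := by rw [← hk]; ring
  have hP1 : 1 ≤ p ^ ℓ := Nat.one_le_pow _ _ (Fact.out : p.Prime).pos
  have hcard : Fintype.card L = Fintype.card Lˣ + 1 := Fintype.card_eq_card_units_add_one L
  have hunits : (Fintype.card Lˣ : ℂ) = ((p ^ ℓ) ^ t : ℕ) ^ 2 - 1 := by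
    rw [eq_sub_iff_add_eq]; exact_mod_cast hcard.symm.trans hL
  have hfilter : (D.filter fun x => (a * x * β⁻¹) ^ ((p ^ ℓ - 1) * k) = 1).card =
      if a⁻¹ * β ∈ D then (p ^ ℓ - 1) * k else 0 := by
    have hiff (x : Lˣ) (hx : (a * x * β⁻¹) ^ ((p ^ ℓ - 1) * k) = 1) : x ∈ D ↔ a⁻¹ * β ∈ D := by
      obtain ⟨y, hy⟩ := IsCyclic.exists_pow_eq_of_pow_eq_one hN hx
      have hcancel : a⁻¹ * β * (a * x * β⁻¹) = x := calc
        _ = (a⁻¹ * a) * (β * β⁻¹) * x := by ac_rfl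
        _ = x := by simp
      rw [← hD (a⁻¹ * β) y, hy, hcancel]
    have hN' : ((p ^ ℓ - 1) * k) * (p ^ ℓ + 1) = Fintype.card Lˣ := by rw [← hk]; ring
    split_ifs with h
    · refine Eq.trans ?_ (IsCyclic.card_filter_pow_eq_one hN')
      refine Finset.card_bij' (fun x _ => a * x * β⁻¹) (fun y _ => a⁻¹ * y * β) ?_ ?_ ?_ ?_
      · simp +contextual
      · intro y hy
        have : (a * (a⁻¹ * y * β) * β⁻¹) ^ ((p ^ ℓ - 1) * k) = 1 := by
          rw [show a * (a⁻¹ * y * β) * β⁻¹ = y by group]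
          simpa using hy
        exact Finset.mem_filter.2 ⟨(hiff _ this).2 h, this⟩
      · intros; group
      · intros; group
    · rw [Finset.card_eq_zero, Finset.filter_eq_empty_iff]
      exact fun x hx h1 => h ((hiff x h1).1 hx)
  have hkey : (Fintype.card Lˣ : ℂ) * ∑ x ∈ D, ψ (a * x) =
      ∑ x ∈ D, ∑ u : Lˣ, ψ ((a * x : Lˣ) * (u : L) ^ (p ^ ℓ + 1)) := by
    rw [Finset.sum_comm, ← nsmul_eq_mul, ← Finset.card_univ, ← Finset.sum_const]
    refine Finset.sum_congr rfl fun u _ => ?_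
    refine Finset.sum_bij' (fun x _ => x * (u⁻¹) ^ (p ^ ℓ + 1)) (fun x _ => x * u ^ (p ^ ℓ + 1))
      ?_ ?_ ?_ ?_ ?_
    · intro x hx; exact (hD _ _).2 hx
    · intro x hx; exact (hD _ _).2 hx
    · intro x _; simp
    · intro x _; simp
    · intro x _
      have hcancel : a * x = a * (x * u⁻¹ ^ (p ^ ℓ + 1)) * u ^ (p ^ ℓ + 1) := by simp [mul_assoc]
      exact_mod_cast congrArg (fun v : Lˣ => ψ v) hcancel
  simp_rw [sum_units_eq hp hℓ ht hL hk hψ hF hβ] at hkey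
  rw [Finset.sum_sub_distrib, Finset.sum_const, nsmul_eq_mul, ← Finset.sum_filter,
    Finset.sum_const, nsmul_eq_mul, hfilter, hc] at hkey
  have hne : (Fintype.card Lˣ : ℂ) ≠ 0 := by exact_mod_cast Fintype.card_ne_zero
  refine mul_left_cancel₀ hne (hkey.trans ?_)
  have hNC : ((p : ℂ) ^ ℓ + 1) * (((p ^ ℓ - 1) * k : ℕ) : ℂ) = Fintype.card Lˣ := by
    exact_mod_cast hN
  split_ifs
  · push_cast at hNC hunits ⊢
    linear_combination -(c : ℂ) * hunits - ((p : ℂ) ^ ℓ) ^ t * hNC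
  · rw [hunits]
    push_cast
    ring

end HermitianSum

section Symplectic

variable {K V : Type*} [Field K] [AddCommGroup V] [Module K V]

theorem LinearMap.IsAlt.nondegenerate {f : V →ₗ[K] V →ₗ[K] K} (halt : f.IsAlt)
    (hnd : ∀ y, (∀ x, f x y = 0) → y = 0) : f.Nondegenerate :=
  ⟨fun x hx => hnd x fun y => by rw [← halt.neg, hx, neg_zero], fun y hy => hnd y hy⟩

theorem LinearMap.IsAlt.exists_apply_eq_one [Nontrivial V] {f : V →ₗ[K] V →ₗ[K] K}
    (hnd : ∀ y, (∀ x, f x y = 0) → y = 0) : ∃ x y, f x y = 1 := by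
  obtain ⟨y, hy⟩ := exists_ne (0 : V)
  obtain ⟨x, hx⟩ : ∃ x, f x y ≠ 0 := by
    by_contra! h
    exact hy (hnd y h)
  exact ⟨(f x y)⁻¹ • x, y, by simp [hx]⟩

/-- The orthogonal complement of a hyperbolic pair. -/
def hyperbolicCompl (f : V →ₗ[K] V →ₗ[K] K) (x y : V) : Submodule K V :=
  LinearMap.BilinForm.orthogonal f (Submodule.span K {x, y})

theorem mem_hyperbolicCompl {f : V →ₗ[K] V →ₗ[K] K} {x y v : V} :
    v ∈ hyperbolicCompl f x y ↔ f x v = 0 ∧ f y v = 0 := by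
  constructor
  · intro h
    exact ⟨h x (Submodule.subset_span (by simp)), h y (Submodule.subset_span (by simp))⟩
  · rintro ⟨hx, hy⟩ w hw
    obtain ⟨a, b, rfl⟩ := Submodule.mem_span_pair.1 hw
    simp [hx, hy]

/-- The orthogonal projection along a hyperbolic pair. -/
def hyperbolicProj {f : V →ₗ[K] V →ₗ[K] K} (halt : f.IsAlt) {x y : V} (h : f x y = 1) :
    V →ₗ[K] hyperbolicCompl f x y :=
  (LinearMap.id - (f.flip y).smulRight x + (f.flip x).smulRight y).codRestrict _ fun v => by
    have hyx : f y x = -1 := by rw [← halt.neg, h]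
    rw [mem_hyperbolicCompl]
    constructor
    · simp [h, halt x, ← halt.neg x v]
    · simp [hyx, halt y, ← halt.neg y v]

theorem coe_hyperbolicProj {f : V →ₗ[K] V →ₗ[K] K} (halt : f.IsAlt) {x y : V} (h : f x y = 1)
    (v : V) : (hyperbolicProj halt h v : V) = v - f v y • x + f v x • y := rfl

theorem hyperbolicCompl_nondegenerate {f : V →ₗ[K] V →ₗ[K] K} (halt : f.IsAlt)
    (hnd : ∀ y, (∀ x, f x y = 0) → y = 0) {x y : V} (h : f x y = 1)
    (w : hyperbolicCompl f x y)
    (hw : ∀ v, f.domRestrict₁₂ (hyperbolicCompl f x y) (hyperbolicCompl f x y) v w = 0) :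
    w = 0 := by
  obtain ⟨h1, h2⟩ := mem_hyperbolicCompl.1 w.2
  refine Subtype.ext (hnd _ fun v => ?_)
  have := hw (hyperbolicProj halt h v)
  simpa [LinearMap.domRestrict₁₂_apply, coe_hyperbolicProj, h1, h2] using this

variable [FiniteDimensional K V]

theorem LinearMap.IsAlt.mem_of_isotropic {f : V →ₗ[K] V →ₗ[K] K} (halt : f.IsAlt)
    (hnd : ∀ y, (∀ x, f x y = 0) → y = 0) {W : Submodule K V} {r : ℕ}
    (hV : finrank K V = 2 * r) (hW : finrank K W = r)
    (hiso : ∀ x ∈ W, ∀ y ∈ W, f x y = 0) {v : V} (hv : ∀ x ∈ W, f x v = 0) : v ∈ W := by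
  have hle : W ≤ LinearMap.BilinForm.orthogonal f W := fun y hy x hx => hiso x hx y hy
  have heq := Submodule.eq_of_le_of_finrank_eq hle (by
    rw [LinearMap.BilinForm.finrank_orthogonal (halt.nondegenerate hnd), hV, hW]; omega)
  rw [heq]
  exact fun x hx => hv x hx

theorem finrank_hyperbolicCompl {f : V →ₗ[K] V →ₗ[K] K} (halt : f.IsAlt)
    (hnd : ∀ y, (∀ x, f x y = 0) → y = 0) {x y : V} (h : f x y = 1) :
    finrank K (hyperbolicCompl f x y) = finrank K V - 2 := by
  have hyx : f y x = -1 := by rw [← halt.neg, h]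
  have hli : LinearIndependent K ![x, y] := by
    rw [LinearIndependent.pair_iff]
    intro s t hst
    have h1 := congrArg (f x) hst
    have h2 := congrArg (f y) hst
    simp only [map_add, map_smul, halt x, halt y, h, hyx, smul_eq_mul, map_zero] at h1 h2
    constructor
    · linear_combination -h2
    · linear_combination h1
  have hspan := finrank_span_eq_card hli
  rw [Matrix.range_cons, Matrix.range_cons, Matrix.range_empty, Set.union_empty,
    Set.singleton_union, Fintype.card_fin] at hspan
  rw [hyperbolicCompl, LinearMap.BilinForm.finrank_orthogonal (halt.nondegenerate hnd), hspan]

theorem exists_isometry_of_isAlt (n : ℕ) {V V' : Type*} [AddCommGroup V] [Module K V]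
    [FiniteDimensional K V] [AddCommGroup V'] [Module K V'] [FiniteDimensional K V']
    {f : V →ₗ[K] V →ₗ[K] K} {f' : V' →ₗ[K] V' →ₗ[K] K}
    (halt : f.IsAlt) (hnd : ∀ y, (∀ x, f x y = 0) → y = 0)
    (halt' : f'.IsAlt) (hnd' : ∀ y, (∀ x, f' x y = 0) → y = 0)
    (hV : finrank K V = n) (hV' : finrank K V' = n) :
    ∃ e : V ≃ₗ[K] V', ∀ x y, f' (e x) (e y) = f x y := by
  suffices ∃ g : V →ₗ[K] V', ∀ x y, f' (g x) (g y) = f x y by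
    obtain ⟨g, hg⟩ := this
    have hinj : Function.Injective g := by
      rw [injective_iff_map_eq_zero]
      intro y hy
      refine hnd y fun x => ?_
      rw [← hg, hy, map_zero]
    exact ⟨g.linearEquivOfInjective hinj (hV.trans hV'.symm), hg⟩
  induction n using Nat.strong_induction_on generalizing V V' with
  | _ n ih =>
  rcases Nat.eq_zero_or_pos n with rfl | hn
  · have := finrank_zero_iff.1 hV
    exact ⟨0, fun x y => by simp [Subsingleton.elim x 0]⟩
  have : Nontrivial V := finrank_pos_iff.1 (hV ▸ hn)
  have : Nontrivial V' := finrank_pos_iff.1 (hV' ▸ hn)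
  obtain ⟨x, y, h⟩ := LinearMap.IsAlt.exists_apply_eq_one hnd
  obtain ⟨x', y', h'⟩ := LinearMap.IsAlt.exists_apply_eq_one hnd'
  obtain ⟨g, hg⟩ := ih (n - 2) (by omega)
    (f := f.domRestrict₁₂ (hyperbolicCompl f x y) (hyperbolicCompl f x y))
    (f' := f'.domRestrict₁₂ (hyperbolicCompl f' x' y') (hyperbolicCompl f' x' y'))
    (fun v => halt v) (hyperbolicCompl_nondegenerate halt hnd h)
    (fun v => halt' v) (hyperbolicCompl_nondegenerate halt' hnd' h')
    (by rw [finrank_hyperbolicCompl halt hnd h, hV])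
    (by rw [finrank_hyperbolicCompl halt' hnd' h', hV'])
  refine ⟨(f.flip y).smulRight x' - (f.flip x).smulRight y' +
    (hyperbolicCompl f' x' y').subtype ∘ₗ g ∘ₗ hyperbolicProj halt h, fun v w => ?_⟩
  have hg' := hg (hyperbolicProj halt h v) (hyperbolicProj halt h w)
  obtain ⟨a1, a2⟩ := mem_hyperbolicCompl.1 (g (hyperbolicProj halt h v)).2
  obtain ⟨b1, b2⟩ := mem_hyperbolicCompl.1 (g (hyperbolicProj halt h w)).2
  rw [← halt'.neg, neg_eq_zero] at a1 a2
  have hyx : f y x = -1 := by rw [← halt.neg, h]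
  have hyx' : f' y' x' = -1 := by rw [← halt'.neg, h']
  simp only [LinearMap.domRestrict₁₂_apply, coe_hyperbolicProj] at hg'
  simp only [LinearMap.add_apply, LinearMap.sub_apply, LinearMap.smulRight_apply,
    LinearMap.flip_apply, LinearMap.comp_apply, Submodule.subtype_apply, map_add, map_sub,
    map_smul, LinearMap.smul_apply, smul_eq_mul, a1, a2, b1, b2, h', hyx', halt' x', halt' y',
    hg', h, hyx, halt x, halt y]
  rw [← halt.neg x w, ← halt.neg y w]
  ring

end Symplectic

section Counting

variable {K V : Type*} [Field K] [AddCommGroup V] [Module K V]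

open Classical in
theorem sum_apply_submodule [Fintype V] {f : V →ₗ[K] V →ₗ[K] K} {φ : AddChar K ℂ} (hφ : φ ≠ 1)
    (W : Submodule K V) (v : V) :
    ∑ x : W, φ (f x v) = if ∀ x ∈ W, f x v = 0 then (Nat.card W : ℂ) else 0 := by
  let χ : AddChar W ℂ := φ.compAddMonoidHom ((f.flip v).domRestrict W).toAddMonoidHom
  have hχ (x : W) : χ x = φ (f x v) := rfl
  simp_rw [← hχ]
  split_ifs with h
  · simp [hχ, h]
  · push Not at h
    obtain ⟨x, hx, hne⟩ := h
    refine AddChar.sum_eq_zero_of_ne_one fun h1 => hφ ?_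
    ext k
    have := DFunLike.congr_fun h1 ((k * (f x v)⁻¹) • ⟨x, hx⟩)
    rw [hχ] at this
    simpa [hne] using this

open Classical in
theorem card_filter_mem_of_sum_apply_eq [FiniteDimensional K V] [Fintype V]
    {f : V →ₗ[K] V →ₗ[K] K} (halt : f.IsAlt)
    (hnd : ∀ y, (∀ x, f x y = 0) → y = 0) {φ : AddChar K ℂ} (hφ : φ ≠ 1) {r c Q : ℕ}
    (hV : finrank K V = 2 * r) {D : Finset V} (h0 : 0 ∉ D) (hc : D.card = c * (Q + 1))
    (hD : ∀ x ≠ 0, ∑ v ∈ D, φ (f x v) = c - (Q : ℂ) * if x ∈ D then 1 else 0)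
    {W : Submodule K V} (hW : finrank K W = r) (hWQ : Nat.card W = Q)
    (hiso : ∀ x ∈ W, ∀ y ∈ W, f x y = 0) : (D.filter (· ∈ W)).card = c := by
  have hmem (v : V) : (∀ x ∈ W, f x v = 0) ↔ v ∈ W :=
    ⟨halt.mem_of_isotropic hnd hV hW hiso, fun hv x hx => hiso x hx v hv⟩
  have h1 : ∑ x : W, ∑ v ∈ D, φ (f x v) = Q * (D.filter (· ∈ W)).card := by
    rw [Finset.sum_comm]
    simp_rw [sum_apply_submodule hφ, hmem, hWQ]
    rw [← Finset.sum_filter, Finset.sum_const, nsmul_eq_mul, mul_comm]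
  have h2 (x : W) : ∑ v ∈ D, φ (f x v) =
      (c - (Q : ℂ) * if (x : V) ∈ D then 1 else 0) + if x = 0 then (c * Q : ℂ) else 0 := by
    split_ifs with hx hx' hx'
    · simp [hx', h0] at hx
    · rw [hD x (by simpa using hx'), if_pos hx, add_zero]
    · simp [hx', hc]; ring
    · rw [hD x (by simpa using hx'), if_neg hx, add_zero]
  have h3 : ∑ x : W, (if (x : V) ∈ D then (1 : ℂ) else 0) = (D.filter (· ∈ W)).card := by
    rw [Finset.sum_boole]
    congr 1
    refine Finset.card_bij (fun x _ => x) ?_ ?_ ?_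
    · intro x hx; simpa using hx
    · intro x _ y _ h; exact Subtype.ext h
    · intro v hv
      obtain ⟨hv, hvW⟩ := Finset.mem_filter.1 hv
      exact ⟨⟨v, hvW⟩, by simpa using hv, rfl⟩
  have hcardW : (Fintype.card W : ℂ) = Q := by rw [← hWQ, Nat.card_eq_fintype_card]
  simp_rw [h2] at h1
  rw [Finset.sum_add_distrib, Finset.sum_sub_distrib, ← Finset.mul_sum, h3, Finset.sum_const,
    Finset.card_univ, nsmul_eq_mul, hcardW, Finset.sum_ite_eq' Finset.univ (0 : W)] at h1
  have hQ : (Q : ℂ) ≠ 0 := by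
    rw [← hWQ]; exact_mod_cast Nat.card_pos.ne'
  have h4 : (2 * (Q : ℂ)) * (D.filter (· ∈ W)).card = 2 * Q * c := by
    simp at h1
    linear_combination -h1
  exact_mod_cast mul_left_cancel₀ (by simpa using hQ) h4

open Classical in
theorem ncard_points_mul [Fintype K] [Fintype V] {D : Finset V} (h0 : 0 ∉ D)
    (hsmul : ∀ a : K, a ≠ 0 → ∀ v ∈ D, a • v ∈ D) (W : Submodule K V) :
    {P ∈ {P : Submodule K V | ∃ v ∈ D, P = K ∙ v} | P ≤ W}.ncard * (Fintype.card K - 1) =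
      (D.filter (· ∈ W)).card := by
  have hset : {P ∈ {P : Submodule K V | ∃ v ∈ D, P = K ∙ v} | P ≤ W} =
      ((D.filter (· ∈ W)).image fun v => K ∙ v : Finset (Submodule K V)) := by
    ext P
    simp only [Set.mem_ofPred_eq, Finset.coe_image, Set.mem_image, Finset.mem_coe,
      Finset.mem_filter]
    constructor
    · rintro ⟨⟨v, hv, rfl⟩, hle⟩
      exact ⟨v, ⟨hv, (Submodule.span_singleton_le_iff_mem v W).1 hle⟩, rfl⟩
    · rintro ⟨v, ⟨hv, hW⟩, rfl⟩
      exact ⟨⟨v, hv, rfl⟩, (Submodule.span_singleton_le_iff_mem v W).2 hW⟩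
  rw [hset, Set.ncard_coe_finset]
  rw [Finset.card_eq_sum_card_image (fun v => K ∙ v) (D.filter (· ∈ W)),
    Finset.sum_const_nat (m := Fintype.card K - 1)]
  intro P hP
  obtain ⟨v, hv, rfl⟩ := Finset.mem_image.1 hP
  obtain ⟨hvD, hvW⟩ := Finset.mem_filter.1 hv
  have hv0 : v ≠ 0 := fun h => h0 (h ▸ hvD)
  rw [← Fintype.card_units, ← Finset.card_univ]
  symm
  refine Finset.card_bij (fun (a : Kˣ) _ => (a : K) • v) ?_ ?_ ?_
  · intro a _
    simp only [Finset.mem_filter]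
    exact ⟨⟨hsmul a a.ne_zero v hvD, W.smul_mem _ hvW⟩,
      Submodule.span_singleton_eq_span_singleton.2 ⟨a⁻¹, by simp [Units.smul_def]⟩⟩
  · intro a _ b _ h
    exact Units.ext (smul_left_injective K hv0 h)
  · intro w hw
    obtain ⟨z, hz⟩ := Submodule.span_singleton_eq_span_singleton.1 (Finset.mem_filter.1 hw).2
    exact ⟨z⁻¹, Finset.mem_univ _, by rw [← hz]; simp [Units.smul_def]⟩

end Counting

open Classical in
theorem IsCyclic.exists_invariant_finset {G : Type*} [CommGroup G] [Fintype G] [IsCyclic G]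
    {d m b : ℕ} (h : d * m = Fintype.card G) (hd : Odd d) (hb : b ≤ d) :
    ∃ D : Finset G, D.card = b * m ∧ (∀ x y, x * y ^ d ∈ D ↔ x ∈ D) ∧
      ∀ x, x⁻¹ ∈ D ↔ x ∈ D := by
  have hH : Fintype.card (powMonoidHom d : G →* G).ker = d := by
    refine Eq.trans ?_ (IsCyclic.card_filter_pow_eq_one h)
    rw [← Fintype.card_subtype]
    exact Fintype.card_congr (Equiv.subtypeEquivRight fun x => MonoidHom.mem_ker)
  obtain ⟨S, hS, hSb⟩ := exists_inv_closed_finset_card_eq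
    (G := (powMonoidHom d : G →* G).ker) (by rwa [hH]) b (by rwa [hH])
  let c (x : G) : (powMonoidHom d : G →* G).ker :=
    ⟨x ^ m, by rw [MonoidHom.mem_ker, powMonoidHom_apply, ← pow_mul, mul_comm, h, pow_card_eq_one]⟩
  refine ⟨Finset.univ.filter fun x => c x ∈ S, ?_, fun x y => ?_, fun x => ?_⟩
  · rw [Finset.card_eq_sum_card_fiberwise (f := c) (t := S) (by intro; simp),
      Finset.sum_const_nat (m := m), hSb]
    intro s hs
    refine Eq.trans ?_ (IsCyclic.card_filter_pow_eq (n := m) (m := d) (by rw [← h, mul_comm])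
      (MonoidHom.mem_ker.1 s.2))
    congr 1
    ext x
    simp only [Finset.mem_filter, Finset.mem_univ, true_and, c, Subtype.ext_iff]
    constructor
    · exact fun hx => hx.2
    · exact fun hx => ⟨by simpa [hx] using hs, hx⟩
  · have : c (x * y ^ d) = c x := by
      ext; simp [c, mul_pow, ← pow_mul, h]
    simp [this]
  · have : c x⁻¹ = (c x)⁻¹ := by
      ext; simp [c]
    simp [this, hS]

theorem FiniteField.trace_pow_card_pow (K : Type*) {L : Type*} [Field K] [Fintype K] [Field L]
    [Finite L] [Algebra K L] (n : ℕ) (x : L) :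
    Algebra.trace K L (x ^ Fintype.card K ^ n) = Algebra.trace K L x := by
  rw [← Algebra.trace_eq_of_algEquiv (frobeniusAlgEquivOfAlgebraic K L ^ n) x, AlgEquiv.coe_pow,
    coe_frobeniusAlgEquivOfAlgebraic_iterate]

section TraceForm

variable (K : Type*) {L : Type*} [Field K] [Fintype K] [Field L] [Algebra K L]

/-- The form `(x, y) ↦ Tr (lam * x ^ Q * y)` with `Q = |K| ^ r`. -/
noncomputable def frobeniusTraceForm (r : ℕ) (lam : L) : L →ₗ[K] L →ₗ[K] K :=
  ((LinearMap.mul K L).compr₂ (Algebra.trace K L)) ∘ₗ LinearMap.mulLeft K lam ∘ₗ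
    (FiniteField.frobeniusAlgHom K L ^ r).toLinearMap

theorem frobeniusTraceForm_apply (r : ℕ) (lam x y : L) :
    frobeniusTraceForm K r lam x y =
      Algebra.trace K L (lam * x ^ Fintype.card K ^ r * y) := by
  simp [frobeniusTraceForm, FiniteField.coe_frobeniusAlgHom, pow_iterate]

variable [Finite L]

theorem frobeniusTraceForm_isAlt {p : ℕ} [CharP K p] (hp : Odd p) {r : ℕ}
    (hr : Nat.card L = (Fintype.card K ^ r) ^ 2) {lam : L}
    (hlam : lam ^ Fintype.card K ^ r = -lam) : (frobeniusTraceForm K r lam).IsAlt := by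
  intro x
  have h := FiniteField.trace_pow_card_pow K r (lam * x ^ Fintype.card K ^ r * x)
  have hx : (x ^ Fintype.card K ^ r) ^ Fintype.card K ^ r = x := by
    have := Fintype.ofFinite L
    rw [← pow_mul, ← sq, ← hr, Nat.card_eq_fintype_card, FiniteField.pow_card]
  rw [mul_pow, mul_pow, hlam, hx, neg_mul, neg_mul, map_neg, mul_right_comm] at h
  rw [frobeniusTraceForm_apply]
  have h2 : (2 : K) ≠ 0 := Ring.two_ne_zero (by
    rw [ringChar.eq K p]; rintro rfl; exact absurd hp (by decide))
  have h3 : 2 * Algebra.trace K L (lam * x ^ Fintype.card K ^ r * x) = 0 := by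
    linear_combination -h
  exact (mul_eq_zero.1 h3).resolve_left h2

theorem frobeniusTraceForm_nondegenerate {r : ℕ}
    (hr : Nat.card L = (Fintype.card K ^ r) ^ 2) {lam : L} (hlam : lam ≠ 0) {y : L}
    (h : ∀ x, frobeniusTraceForm K r lam x y = 0) : y = 0 := by
  refine (traceForm_nondegenerate K L).2 y fun z => ?_
  have := Fintype.ofFinite L
  have hx : lam * ((z / lam) ^ Fintype.card K ^ r) ^ Fintype.card K ^ r = z := by
    rw [← pow_mul, ← sq, ← hr, Nat.card_eq_fintype_card, FiniteField.pow_card]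
    field_simp
  have := h ((z / lam) ^ Fintype.card K ^ r)
  rwa [frobeniusTraceForm_apply, hx] at this

end TraceForm

theorem exists_addChar_trace (K L : Type*) [Field K] [Finite K] [Field L] [Finite L]
    [Algebra K L] (p : ℕ) [Fact p.Prime] [CharP K p] : ∃ φ : AddChar K ℂ, φ ≠ 1 ∧
      φ.compAddMonoidHom (Algebra.trace K L).toAddMonoidHom ≠ 1 ∧
      ∀ (n : ℕ) (x : L), φ (Algebra.trace K L (x ^ p ^ n)) = φ (Algebra.trace K L x) := by
  have : CharP L p := charP_of_injective_algebraMap (algebraMap K L).injective p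
  let := ZMod.algebra K p
  let := ZMod.algebra L p
  have : IsScalarTower (ZMod p) K L := .of_algebraMap_eq' (Subsingleton.elim _ _)
  have hχ : (ZMod.stdAddChar : AddChar (ZMod p) ℂ) ≠ 1 := by
    intro h
    have := ZMod.injective_stdAddChar (N := p) (a₁ := 0) (a₂ := 1) (by simp [h])
    exact zero_ne_one this
  set φ : AddChar K ℂ :=
    ZMod.stdAddChar.compAddMonoidHom (Algebra.trace (ZMod p) K).toAddMonoidHom
  have hφL (x : L) : φ (Algebra.trace K L x) = ZMod.stdAddChar (Algebra.trace (ZMod p) L x) := by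
    rw [← Algebra.trace_trace (R := ZMod p) (S := K)]; rfl
  have hψ : φ.compAddMonoidHom (Algebra.trace K L).toAddMonoidHom ≠ 1 := by
    refine fun h => hχ ?_
    ext a
    obtain ⟨x, rfl⟩ := Algebra.trace_surjective (ZMod p) L a
    rw [← hφL]
    exact DFunLike.congr_fun h x
  refine ⟨φ, fun h => hψ (by rw [h]; rfl), hψ, fun n x => ?_⟩
  have := FiniteField.trace_pow_card_pow (ZMod p) n x
  rw [ZMod.card] at this
  rw [hφL, hφL, this]

theorem FiniteField.exists_units_pow_eq_neg_one {L : Type*} [Field L] [Fintype L] [DecidableEq L]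
    {n m d : ℕ}
    (h : n * m = Fintype.card Lˣ) (hm : Even m) (hd : Odd d) : ∃ y : Lˣ, (y ^ d) ^ n = -1 := by
  obtain ⟨y, hy⟩ := IsCyclic.exists_pow_eq_of_pow_eq_one h (u := (-1 : Lˣ)) hm.neg_one_pow
  exact ⟨y, by rw [pow_right_comm, hy, hd.neg_one_pow]⟩

open Classical in
theorem exists_finset_sum_eq {K L : Type*} [Field K] [Fintype K] [Field L] [Fintype L]
    [Algebra K L] {p ℓ t r d b u : ℕ} [Fact p.Prime] [CharP K p] (hp : Odd p) (hℓ : 0 < ℓ)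
    (ht : Even t) (hK : Fintype.card K ^ r = (p ^ ℓ) ^ t)
    (hL : Fintype.card L = (Fintype.card K ^ r) ^ 2) (hd : Odd d) (hdP : d ∣ p ^ ℓ + 1)
    (hu : Fintype.card K ^ r - 1 = d * ((Fintype.card K - 1) * u)) (hb : b ≤ d) :
    ∃ (f : L →ₗ[K] L →ₗ[K] K) (φ : AddChar K ℂ) (D : Finset L), f.IsAlt ∧
      (∀ y, (∀ x, f x y = 0) → y = 0) ∧ φ ≠ 1 ∧ 0 ∉ D ∧
      D.card = b * ((Fintype.card K - 1) * u) * (Fintype.card K ^ r + 1) ∧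
      (∀ x ≠ 0, ∑ v ∈ D, φ (f x v) = (b * ((Fintype.card K - 1) * u) : ℕ) -
        ((Fintype.card K ^ r : ℕ) : ℂ) * if x ∈ D then 1 else 0) ∧
      ∀ a : K, a ≠ 0 → ∀ x ∈ D, a • x ∈ D := by
  have : CharP L p := charP_of_injective_algebraMap (algebraMap K L).injective p
  have hQ0 : 0 < Fintype.card K ^ r := pow_pos Fintype.card_pos r
  have hqQ : (Fintype.card K ^ r - 1) * (Fintype.card K ^ r + 1) = Fintype.card Lˣ := by
    rw [Fintype.card_units, hL, mul_comm, ← Nat.sq_sub_sq, one_pow]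
  have hPodd : Odd (p ^ ℓ) := hp.pow
  obtain ⟨k, hk⟩ : ∃ k, (p ^ ℓ - 1) * ((p ^ ℓ + 1) * k) = Fintype.card Lˣ := by
    have := Nat.sub_dvd_pow_sub_pow ((p ^ ℓ) ^ 2) 1 t
    rw [one_pow, ← pow_mul (p ^ ℓ) 2, mul_comm 2 t, pow_mul, ← hK, ← hL,
      ← Fintype.card_units] at this
    obtain ⟨k, hk⟩ := this
    refine ⟨k, ?_⟩
    rw [hk, ← mul_assoc, mul_comm (p ^ ℓ - 1), ← Nat.sq_sub_sq, one_pow]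
  obtain ⟨β, hβ⟩ := FiniteField.exists_units_pow_eq_neg_one hk
    (hPodd.add_one.mul_right k) hd
  obtain ⟨lam, hlam⟩ := FiniteField.exists_units_pow_eq_neg_one hqQ
    (by rw [hK]; exact hPodd.pow.add_one) hd
  have hdm : d * ((Fintype.card K - 1) * u * (Fintype.card K ^ r + 1)) = Fintype.card Lˣ := by
    rw [← hqQ, hu]; ring
  obtain ⟨D, hDc, hDd, hDi⟩ := IsCyclic.exists_invariant_finset hdm hd hb
  obtain ⟨φ, hφ, hψ, hF⟩ := exists_addChar_trace K L p
  have hcardL : Nat.card L = (Fintype.card K ^ r) ^ 2 := by rw [Nat.card_eq_fintype_card, hL]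
  have hlam' : ((lam ^ d : Lˣ) : L) ^ Fintype.card K ^ r = -(lam ^ d : Lˣ) := by
    have h := congrArg (fun z : Lˣ => ((z * lam ^ d : Lˣ) : L)) hlam
    simp only [← pow_succ, Nat.sub_add_cancel hQ0] at h
    simpa using h
  refine ⟨frobeniusTraceForm K r (lam ^ d : Lˣ), φ, D.map ⟨Units.val, Units.val_injective⟩,
    frobeniusTraceForm_isAlt K hp hcardL hlam',
    fun y => frobeniusTraceForm_nondegenerate K hcardL (Units.ne_zero _), hφ, by simp,
    by rw [Finset.card_map, hDc]; ring, fun x hx => ?_, fun a ha x hx => ?_⟩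
  · obtain ⟨x, rfl⟩ := hx.isUnit
    have hsum := sum_apply_mul_eq hp hℓ ht (by rw [hL, hK]) hk hψ (hF ℓ) hβ (D := D)
      (c := b * ((Fintype.card K - 1) * u))
      (fun x y => by
        obtain ⟨j, hj⟩ := hdP
        rw [hj, mul_comm d, pow_mul, hDd])
      (by rw [hDc, hK]; ring) (lam ^ d * x ^ Fintype.card K ^ r)
    have hmem : (lam ^ d * x ^ Fintype.card K ^ r)⁻¹ * β ^ d ∈ D ↔ x ∈ D := by
      rw [← hDi x, ← hDd x⁻¹ (lam⁻¹ * (x ^ ((Fintype.card K - 1) * u))⁻¹ * β)]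
      have : x ^ Fintype.card K ^ r = x * (x ^ ((Fintype.card K - 1) * u)) ^ d := by
        rw [← pow_mul, mul_comm _ d, ← hu, ← pow_succ', Nat.sub_add_cancel hQ0]
      rw [this, mul_pow, mul_pow, inv_pow, inv_pow, mul_inv, mul_inv]
      rw [mul_left_comm (lam ^ d)⁻¹, mul_assoc x⁻¹]
    simp only [hmem] at hsum
    rw [Finset.sum_map, ← hK] at *
    simp only [Function.Embedding.coeFn_mk, frobeniusTraceForm_apply]
    simpa using hsum
  · obtain ⟨x, hxD, rfl⟩ := Finset.mem_map.1 hx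
    rw [Function.Embedding.coeFn_mk]
    obtain ⟨y, hy⟩ := IsCyclic.exists_pow_eq_of_pow_eq_one hdm
      (u := Units.map (algebraMap K L).toMonoidHom (Units.mk0 a ha))
      (by
        rw [← map_pow, mul_assoc, pow_mul, ← Fintype.card_units, pow_card_eq_one, one_pow, map_one])
    refine Finset.mem_map.2 ⟨x * y ^ d, (hDd x y).2 hxD, ?_⟩
    rw [hy]
    simp [Algebra.smul_def, mul_comm]

theorem odd_pow_sub_one_div {p r : ℕ} (e : ℕ) (hp : Odd p) (hp2 : 2 ≤ p ^ e) (hr : Odd r) :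
    Odd ((p ^ (e * r) - 1) / (p ^ e - 1)) := by
  rw [pow_mul, ← Nat.geomSum_eq hp2, Finset.odd_sum_iff_odd_card_odd]
  rwa [Finset.filter_true_of_mem fun _ _ => hp.pow.pow, Finset.card_range]

/-- Let `p` be an odd prime, `s = 2er = 2ℓt` with `r` odd and `t` even, `q = p^s`,
`N = p^ℓ+1`, `√q = p^{er}`, and `d₀ = gcd(N/2, (√q-1)/(p^e-1))`. If `d₀ > 1`, then
for each integer `1 ≤ b ≤ d₀-1` there exists a `(b(√q-1)/(d₀(p^e-1)))`-ovoid in the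
symplectic polar space `W(2r-1, p^e)`; i.e., in any `2r`-dimensional vector space `V`
over `F_{p^e}` equipped with a non-degenerate alternating bilinear form `f`, there is
a set `M` of projective points (`1`-dimensional subspaces) such that every maximal
totally isotropic subspace (vector dimension `r`) contains exactly
`b(√q-1)/(d₀(p^e-1))` points of `M`. -/
theorem statement_15 (p e r ℓ t d₀ b : ℕ) (hp : p.Prime) (hpodd : Odd p)
    (he : 0 < e) (hℓ : 0 < ℓ) (h0t : 0 < t) (hr : Odd r) (hr2 : 2 ≤ r) (ht : Even t)
    (hs : e * r = ℓ * t)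
    (hd₀ : d₀ = Nat.gcd ((p ^ ℓ + 1) / 2) ((p ^ (e * r) - 1) / (p ^ e - 1)))
    (hd₀1 : 1 < d₀) (hb1 : 1 ≤ b) (hb2 : b ≤ d₀ - 1)
    (K : Type*) [Field K] [Fintype K] (hK : Fintype.card K = p ^ e)
    (V : Type*) [AddCommGroup V] [Module K V] [FiniteDimensional K V]
    (hV : finrank K V = 2 * r)
    (f : V →ₗ[K] V →ₗ[K] K)
    (halt : ∀ x, f x x = 0)
    (hnd : ∀ y, (∀ x, f x y = 0) → y = 0) :
    ∃ M : Set (Submodule K V), (∀ P ∈ M, finrank K P = 1) ∧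
      ∀ W : Submodule K V, (∀ x ∈ W, ∀ y ∈ W, f x y = 0) → finrank K W = r →
        {P ∈ M | P ≤ W}.ncard = b * ((p ^ (e * r) - 1) / (d₀ * (p ^ e - 1))) := by
  classical
  have := Fact.mk hp
  have : CharP K p := by
    obtain ⟨p', hp'⟩ := CharP.exists K
    have := Fact.mk (CharP.char_is_prime K p')
    obtain ⟨n, hn, hc⟩ := FiniteField.card K p'
    rw [hK] at hc
    have := (Nat.prime_dvd_prime_iff_eq hp (CharP.char_is_prime K p')).1
      (hp.dvd_of_dvd_pow (hc ▸ dvd_pow_self p he.ne'))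
    rwa [this]
  have hpe : 2 ≤ p ^ e := hK ▸ Fintype.one_lt_card
  have hdodd : Odd d₀ := Odd.of_dvd_nat (odd_pow_sub_one_div e hpodd hpe hr)
    (hd₀ ▸ Nat.gcd_dvd_right _ _)
  obtain ⟨u, hu⟩ : d₀ ∣ (p ^ (e * r) - 1) / (p ^ e - 1) := hd₀ ▸ Nat.gcd_dvd_right _ _
  have hdP : d₀ ∣ p ^ ℓ + 1 := (hd₀ ▸ Nat.gcd_dvd_left _ _ : d₀ ∣ (p ^ ℓ + 1) / 2).trans
    (Nat.div_dvd_of_dvd hpodd.pow.add_one.two_dvd)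
  have hQ : p ^ (e * r) - 1 = d₀ * ((p ^ e - 1) * u) := by
    have hdvd : p ^ e - 1 ∣ p ^ (e * r) - 1 := by
      simpa [pow_mul] using Nat.sub_dvd_pow_sub_pow (p ^ e) 1 r
    rw [← Nat.mul_div_cancel' hdvd, hu]
    ring
  have : NeZero (2 * r) := ⟨by omega⟩
  let L := FiniteField.Extension K p (2 * r)
  let := Fintype.ofFinite L
  have hL : Fintype.card L = (Fintype.card K ^ r) ^ 2 := by
    rw [← Nat.card_eq_fintype_card, FiniteField.natCard_extension, Nat.card_eq_fintype_card,
      ← pow_mul, mul_comm]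
  obtain ⟨g, φ, D, hg, hgnd, hφ, h0, hc, hsum, hsmul⟩ := exists_finset_sum_eq (K := K) (L := L)
    hpodd hℓ ht (r := r) (u := u) (by rw [hK, ← pow_mul, hs, pow_mul]) hL hdodd hdP
    (by rw [hK, ← pow_mul, hQ]) (b := b) (by omega)
  obtain ⟨iso, hiso⟩ := exists_isometry_of_isAlt (2 * r) halt hnd hg hgnd hV
    (FiniteField.finrank_extension K p (2 * r))
  let := Fintype.ofEquiv L iso.symm.toEquiv
  let E : Finset V := D.map iso.symm.toEquiv.toEmbedding
  have hE (v : V) : v ∈ E ↔ iso v ∈ D := by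
    simp [E]
  have hE0 : 0 ∉ E := by simpa [hE] using h0
  refine ⟨{P | ∃ v ∈ E, P = K ∙ v}, ?_, fun W hW hWr => ?_⟩
  · rintro P ⟨v, hv, rfl⟩
    exact finrank_span_singleton fun h => hE0 (h ▸ hv)
  · have h1 := card_filter_mem_of_sum_apply_eq halt hnd hφ hV hE0
      (by rw [Finset.card_map, hc]) (fun x hx => ?_) hWr
      (by rw [Module.natCard_eq_pow_finrank (K := K), hWr, Nat.card_eq_fintype_card]) hW
    · have h2 := ncard_points_mul hE0 (fun a ha v hv => by
        rw [hE] at hv ⊢; rw [map_smul]; exact hsmul a ha _ hv) W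
      rw [h1, hK, ← mul_assoc, mul_right_comm] at h2
      rw [Nat.eq_of_mul_eq_mul_right (by omega) h2, hQ, ← mul_assoc,
        Nat.mul_div_cancel_left _ (Nat.mul_pos (by omega) (by omega))]
    · have := hsum (iso x) (by simpa using hx)
      rw [Finset.sum_map]
      simpa [hE, ← hiso] using this
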